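/- (High×high interactions with equal signs.) Let 0 < α ≤ 1, 1 < r ≤ 2 with conjugate exponent r′, and b > 1/r. There exists C > 0 (depending only on α, r, b) such that for all parameters N₁, N₂ ≥ 1 with N₁/2 ≤ N₂ ≤ 2N₁, and all nonnegative measurable functions f₁, f₂ on ℝ² with supp f₁ ⊂ {(ξ₁,σ₁) : N₁ ≤ ξ₁ ≤ 2N₁} and supp f₂ ⊂ {(ξ₂,σ₂) : N₂ ≤ ξ₂ ≤ 2N₂}, and every nonnegative f ∈ L^r(ℝ²), one has J(f₁,f₂,f) ≤ C N₁^{−α/(2r)} ‖⟨σ₁⟩^b f₁(ξ₁,σ₁)‖_{L^{r′}(ℝ²)} ‖⟨σ₂⟩^b f₂(ξ₂,σ₂)‖_{L^{r′}(ℝ²)} ‖f‖_{L^r}. -/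

import Mathlib

open MeasureTheory ENNReal

/-- Dispersion relation of the dispersion generalized Benjamin–Ono equation. -/
noncomputable def omegaBO (α ξ : ℝ) : ℝ := -ξ * |ξ| ^ (1 + α)

/-- Resonance function. -/
noncomputable def resBO (α ξ₁ ξ₂ : ℝ) : ℝ :=
  omegaBO α ξ₁ + omegaBO α ξ₂ - omegaBO α (ξ₁ + ξ₂)

/-- Dyadic frequency-modulation region. -/
def Dset (M K : ℝ) : Set (ℝ × ℝ) :=
  {z | M ≤ |z.1| ∧ |z.1| ≤ 2 * M ∧ K ≤ |z.2| ∧ |z.2| ≤ 2 * K}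

/-- The trilinear convolution functional J(f₁,f₂,f). -/
noncomputable def Jfun (α : ℝ) (f₁ f₂ f : ℝ × ℝ → ℝ) : ℝ≥0∞ :=
  ∫⁻ w : (ℝ × ℝ) × ℝ × ℝ,
    ENNReal.ofReal (f₁ (w.1.1, w.1.2) * f₂ (w.2.1, w.2.2) *
      f (w.1.1 + w.2.1, w.1.2 + w.2.2 + resBO α w.1.1 w.2.1))

/-- The L^p norm (with real exponent p) of a nonnegative function on ℝ². -/
noncomputable def LpN (p : ℝ) (f : ℝ × ℝ → ℝ) : ℝ≥0∞ :=
  (∫⁻ z : ℝ × ℝ, ENNReal.ofReal (f z) ^ p) ^ (1 / p)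

/-- The Japanese bracket ⟨σ⟩ = (1+σ²)^{1/2}. -/
noncomputable def jap (σ : ℝ) : ℝ := (1 + σ ^ 2) ^ ((1 : ℝ) / 2)

noncomputable def phi (α ξ x : ℝ) : ℝ := x ^ (2+α) + (ξ - x) ^ (2+α)

lemma phi_mono (α M ξ x y : ℝ) (hα : 0 < α) (hM : 0 < M) (hy : ξ / 2 ≤ y) (hyx : y ≤ x)
    (hx : x ≤ ξ - M) : 2 * M ^ α * (x - y) ^ 2 ≤ phi α ξ x - phi α ξ y := by
  have hd : ∀ u : ℝ, 0 < u → 0 < ξ - u →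
      HasDerivAt (fun u => phi α ξ u - 2 * M ^ α * (u - ξ / 2) ^ 2)
      ((2+α) * u ^ (1+α) - (2+α) * (ξ-u) ^ (1+α) - 2 * M ^ α * (2 * (u - ξ/2))) u := by
    intro u hu hu'
    have h1 : HasDerivAt (fun u : ℝ => u ^ (2+α)) ((2+α) * u ^ (1+α)) u := by
      have := Real.hasDerivAt_rpow_const (x := u) (p := 2+α) (Or.inl hu.ne')
      rwa [show 2 + α - 1 = 1 + α by ring] at this
    have h2 : HasDerivAt (fun v : ℝ => (ξ - v) ^ (2+α)) (-((2+α) * (ξ-u) ^ (1+α))) u := by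
      have := (((hasDerivAt_id u).const_sub ξ)).rpow_const (p := 2+α) (Or.inl hu'.ne')
      rw [show 2 + α - 1 = 1 + α by ring] at this
      refine HasDerivAt.congr_deriv this ?_
      simp only [id]; ring
    have h3 : HasDerivAt (fun v : ℝ => 2 * M ^ α * (v - ξ/2) ^ 2) (2 * M ^ α * (2 * (u - ξ/2))) u := by
      have := (((hasDerivAt_id u).sub_const (ξ/2)).pow 2).const_mul (2 * M ^ α)
      refine HasDerivAt.congr_deriv this ?_
      simp
    refine HasDerivAt.congr_deriv ((h1.add h2).sub h3) ?_
    ring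
  have hmono : MonotoneOn (fun u => phi α ξ u - 2 * M ^ α * (u - ξ / 2) ^ 2) (Set.Icc (ξ/2) (ξ - M)) := by
    have hpos : ∀ u ∈ Set.Icc (ξ/2) (ξ - M), 0 < u ∧ 0 < ξ - u := by
      rintro u ⟨h1, h2⟩
      constructor <;> linarith
    apply monotoneOn_of_deriv_nonneg (convex_Icc _ _)
    · intro u hu
      exact (hd u (hpos u hu).1 (hpos u hu).2).continuousAt.continuousWithinAt
    · intro u hu
      have hu := interior_subset hu
      exact (hd u (hpos u hu).1 (hpos u hu).2).differentiableAt.differentiableWithinAt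
    · intro u hu
      have hu := interior_subset hu
      obtain ⟨p1, p2⟩ := hpos u hu
      rw [(hd u p1 p2).deriv, Real.rpow_add p1, Real.rpow_add p2, Real.rpow_one, Real.rpow_one]
      obtain ⟨h1, h2⟩ := hu
      have a1 : M ^ α ≤ (ξ - u) ^ α := Real.rpow_le_rpow hM.le (by linarith) hα.le
      have a2 : (ξ - u) ^ α ≤ u ^ α := Real.rpow_le_rpow p2.le (by linarith) hα.le
      have a0 : 0 < M ^ α := Real.rpow_pos_of_pos hM _
      have b1 : 0 ≤ 2 * u - ξ := by linarith
      have b2 : M ^ α * (2 * u - ξ) ≤ u * u ^ α - (ξ - u) * (ξ - u) ^ α := by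
        nlinarith [mul_le_mul_of_nonneg_left a2 p1.le, mul_le_mul_of_nonneg_right a1 b1]
      have b3 : 0 ≤ M ^ α * (2 * u - ξ) := by positivity
      nlinarith
  have := hmono (a := y) (b := x) ⟨hy, by linarith⟩ ⟨by linarith, hx⟩ hyx
  simp only at this
  have a0 : 0 < M ^ α := Real.rpow_pos_of_pos hM _
  have : 2 * M ^ α * ((x - ξ/2)^2 - (y - ξ/2)^2 - (x-y)^2) ≥ 0 := by
    have : (x - ξ/2)^2 - (y - ξ/2)^2 - (x-y)^2 = 2 * (x - y) * (y - ξ/2) := by ring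
    rw [this]
    have := sub_nonneg.2 hyx
    have := sub_nonneg.2 hy
    positivity
  linarith

lemma phi_symm (α ξ x : ℝ) : phi α ξ (ξ - x) = phi α ξ x := by
  simp [phi, add_comm]

lemma phi_abs (α M ξ x y : ℝ) (hα : 0 < α) (hM : 0 < M) (hy : ξ / 2 ≤ y) (hx0 : ξ / 2 ≤ x)
    (hx : x ≤ ξ - M) (hy' : y ≤ ξ - M) : 2 * M ^ α * (x - y) ^ 2 ≤ |phi α ξ x - phi α ξ y| := by
  rcases le_total y x with h | h
  · exact (phi_mono α M ξ x y hα hM hy h hx).trans (le_abs_self _)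
  · rw [abs_sub_comm]
    refine le_trans ?_ ((phi_mono α M ξ y x hα hM hx0 h hy').trans (le_abs_self _))
    apply le_of_eq; ring

lemma phi_abs' (α M ξ x y : ℝ) (hα : 0 < α) (hM : 0 < M) (hy : y ≤ ξ / 2) (hx0 : x ≤ ξ / 2)
    (hx : M ≤ x) (hy' : M ≤ y) : 2 * M ^ α * (x - y) ^ 2 ≤ |phi α ξ x - phi α ξ y| := by
  have := phi_abs α M ξ (ξ - x) (ξ - y) hα hM (by linarith) (by linarith) (by linarith) (by linarith)
  rw [phi_symm, phi_symm] at this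
  refine le_trans (le_of_eq ?_) this
  ring

lemma phi_cont (α ξ : ℝ) (hα : 0 < α) : Continuous (phi α ξ) := by
  unfold phi
  exact (Real.continuous_rpow_const (by linarith)).add
    ((Real.continuous_rpow_const (by linarith)).comp (continuous_const.sub continuous_id))

lemma near_pt (g : ℝ → ℝ) (hg : Continuous g) (κ a b c : ℝ)
    (h : ∀ x ∈ Set.Icc a b, ∀ y ∈ Set.Icc a b, 2 * κ * (x - y) ^ 2 ≤ |g x - g y|) :
    ∃ t, ∀ x ∈ Set.Icc a b, κ * (x - t) ^ 2 ≤ |g x - c| := by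
  by_cases hab : a ≤ b
  · obtain ⟨t, ht, hm⟩ := isCompact_Icc.exists_isMinOn (Set.nonempty_Icc.2 hab)
      ((hg.sub continuous_const).abs.continuousOn (s := Set.Icc a b) (f := fun x => |g x - c|))
    refine ⟨t, fun x hx => ?_⟩
    have h1 := h x hx t ht
    have h2 : |g t - c| ≤ |g x - c| := hm hx
    have h3 : |g x - g t| ≤ |g x - c| + |g t - c| := by
      rw [abs_sub_comm (g t) c]; exact abs_sub_le _ _ _
    linarith
  · exact ⟨0, fun x hx => absurd (hx.1.trans hx.2) hab⟩

noncomputable def kk (p y : ℝ) : ℝ := (1 + y ^ 2) ^ (-(p / 2))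

lemma kk_int (p : ℝ) (hp : 1 < p) : ∫⁻ y, ENNReal.ofReal (kk p y) < ⊤ := by
  have := integrable_rpow_neg_one_add_norm_sq (E := ℝ) (μ := volume) (r := p) (by simpa using hp)
  have := this.lintegral_lt_top
  simpa [kk, neg_div] using this

lemma kk_sq (p y : ℝ) (hp : 1 < p) : kk p (y ^ 2) ≤ 2 ^ (p/2) * kk p y := by
  unfold kk
  rw [Real.rpow_neg (by positivity), Real.rpow_neg (by positivity), ← div_eq_mul_inv,
    inv_eq_one_div, div_le_div_iff₀ (by positivity) (by positivity), one_mul,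
    ← Real.mul_rpow (by positivity) (by positivity)]
  apply Real.rpow_le_rpow (by positivity) _ (by linarith)
  nlinarith [sq_nonneg (y^2 - 1), sq_nonneg (y^2)]

lemma kk_anti (p x y : ℝ) (hp : 1 < p) (h : |x| ≤ |y|) : kk p y ≤ kk p x := by
  unfold kk
  apply Real.rpow_le_rpow_of_nonpos (by positivity) _ (by linarith)
  have := sq_le_sq.2 h
  linarith

lemma kk_meas (p : ℝ) : Measurable (kk p) := by
  unfold kk; fun_prop

lemma int_scale (p l t : ℝ) (hp : 1 < p) (hl : 0 < l) :
    ∫⁻ x, ENNReal.ofReal (kk p ((l * (x - t)) ^ 2)) ≤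
     ENNReal.ofReal (l⁻¹ * 2 ^ (p/2)) * ∫⁻ y, ENNReal.ofReal (kk p y) := by
  have hm := kk_meas p
  calc _ ≤ ∫⁻ x, ENNReal.ofReal (2 ^ (p/2)) * ENNReal.ofReal (kk p (l * (x - t))) := by
        apply lintegral_mono; intro x
        simp only
        rw [← ENNReal.ofReal_mul (by positivity)]
        exact ENNReal.ofReal_le_ofReal (kk_sq p _ hp)
    _ = ENNReal.ofReal (2 ^ (p/2)) * ∫⁻ x, ENNReal.ofReal (kk p (l * (x - t))) := by
        rw [lintegral_const_mul _ (by fun_prop)]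
    _ = ENNReal.ofReal (2 ^ (p/2)) * ∫⁻ x, ENNReal.ofReal (kk p (l * x)) := by
        rw [lintegral_sub_right_eq_self (fun x => ENNReal.ofReal (kk p (l * x))) t]
    _ = ENNReal.ofReal (2 ^ (p/2)) * (ENNReal.ofReal l⁻¹ * ∫⁻ x, ENNReal.ofReal (kk p x)) := by
        congr 1
        have h := Real.map_volume_mul_left hl.ne'
        rw [abs_of_pos (by positivity)] at h
        rw [← lintegral_map (f := fun y => ENNReal.ofReal (kk p y)) (g := fun x => l * x) (by fun_prop) (by fun_prop)]
        change ∫⁻ a, ENNReal.ofReal (kk p a) ∂(Measure.map (l * ·) volume) = _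
        rw [h, lintegral_smul_measure]; rfl
    _ = _ := by
        rw [mul_comm l⁻¹, ENNReal.ofReal_mul (by positivity), mul_assoc]

lemma int_half (p κ a b c : ℝ) (g : ℝ → ℝ) (hg : Continuous g) (hp : 1 < p) (hκ : 0 < κ)
    (h : ∀ x ∈ Set.Icc a b, ∀ y ∈ Set.Icc a b, 2 * κ * (x - y) ^ 2 ≤ |g x - g y|) :
    ∫⁻ x in Set.Icc a b, ENNReal.ofReal (kk p (g x - c)) ≤
     ENNReal.ofReal (κ ^ (-(1/2:ℝ)) * 2 ^ (p/2)) * ∫⁻ y, ENNReal.ofReal (kk p y) := by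
  obtain ⟨t, ht⟩ := near_pt g hg κ a b c h
  have hm := kk_meas p
  have hl : 0 < κ ^ (1/2:ℝ) := by positivity
  have hk : (κ ^ (1/2:ℝ))^2 = κ := by
    rw [← Real.rpow_natCast, ← Real.rpow_mul hκ.le]; norm_num
  have := int_scale p (κ ^ (1/2:ℝ)) t hp hl
  rw [← Real.rpow_neg hκ.le] at this
  refine le_trans ?_ this
  refine le_trans ?_ (setLIntegral_le_lintegral (Set.Icc a b) _)
  apply setLIntegral_mono' measurableSet_Icc
  intro x hx
  apply ENNReal.ofReal_le_ofReal
  apply kk_anti p _ _ hp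
  rw [mul_pow, hk, abs_of_nonneg (by positivity)]
  exact ht x hx

lemma int_phi (α M ξ p c : ℝ) (hα : 0 < α) (hM : 0 < M) (hp : 1 < p) :
    ∫⁻ x in Set.Icc M (ξ - M), ENNReal.ofReal (kk p (phi α ξ x - c)) ≤
     2 * (ENNReal.ofReal ((M ^ α) ^ (-(1/2:ℝ)) * 2 ^ (p/2)) * ∫⁻ y, ENNReal.ofReal (kk p y)) := by
  have hs : Set.Icc M (ξ - M) ⊆ Set.Icc M (ξ/2) ∪ Set.Icc (ξ/2) (ξ - M) := by
    rintro x ⟨h1, h2⟩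
    rcases le_total x (ξ/2) with h | h
    · exact Or.inl ⟨h1, h⟩
    · exact Or.inr ⟨h, h2⟩
  refine (lintegral_mono_set hs).trans ((lintegral_union_le _ _ _).trans ?_)
  rw [two_mul]
  have hκ : 0 < M ^ α := by positivity
  apply add_le_add
  · apply int_half p _ _ _ _ _ (phi_cont α ξ hα) hp hκ
    intro x hx y hy
    exact phi_abs' α M ξ x y hα hM hy.2 hx.2 hx.1 hy.1
  · apply int_half p _ _ _ _ _ (phi_cont α ξ hα) hp hκ
    intro x hx y hy
    exact phi_abs α M ξ x y hα hM hy.1 hx.1 hx.2 hy.2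

lemma omegaBO_meas (α : ℝ) : Measurable (omegaBO α) := by
  unfold omegaBO; fun_prop

lemma res_meas (α : ℝ) : Measurable (fun z : ℝ × ℝ => resBO α z.1 z.2) := by
  have := omegaBO_meas α
  unfold resBO; fun_prop

lemma omega_pos (α x : ℝ) (hx : 0 < x) : omegaBO α x = -x ^ (2+α) := by
  unfold omegaBO
  rw [abs_of_pos hx, show 2 + α = 1 + (1 + α) by ring, Real.rpow_add hx 1 (1 + α), Real.rpow_one,
    neg_mul]

lemma res_phi (α M ξ x : ℝ) (hM : 0 < M) (h1 : M ≤ x) (h2 : M ≤ ξ - x) :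
    resBO α x (ξ - x) = - phi α ξ x - omegaBO α ξ := by
  unfold resBO phi
  rw [omega_pos α x (by linarith), omega_pos α (ξ - x) (by linarith), add_sub_cancel]
  ring

lemma shear_mp (α : ℝ) : MeasurePreserving
    (fun w : (ℝ × ℝ) × (ℝ × ℝ) =>
      (w.1, ((w.1.1 + w.2.1, w.1.2 + w.2.2 + resBO α w.1.1 w.2.1) : ℝ × ℝ))) volume volume := by
  have hr := res_meas α
  have hr' : ∀ {γ : Type} [MeasurableSpace γ] (u v : γ → ℝ), Measurable u → Measurable v →
      Measurable (fun x => resBO α (u x) (v x)) := fun u v hu hv => hr.comp (hu.prodMk hv)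
  refine MeasurePreserving.skew_product (μa := (volume : Measure (ℝ × ℝ)))
    (μc := (volume : Measure (ℝ × ℝ))) (μb := volume) (μd := volume)
    (f := fun z1 => z1) (MeasurePreserving.id _)
    (g := fun z1 z2 => ((z1.1 + z2.1, z1.2 + z2.2 + resBO α z1.1 z2.1) : ℝ × ℝ)) ?_ ?_
  · unfold Function.uncurry
    apply Measurable.prodMk (by fun_prop)
    apply Measurable.add (by fun_prop)
    exact hr' _ _ (by fun_prop) (by fun_prop)
  · refine Filter.Eventually.of_forall fun z1 => ?_
    refine (MeasurePreserving.skew_product (μa := (volume : Measure ℝ)) (μc := (volume : Measure ℝ))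
      (μb := volume) (μd := volume)
      (f := fun x => z1.1 + x) (measurePreserving_add_left volume z1.1)
      (g := fun x s => z1.2 + s + resBO α z1.1 x) ?_ ?_).map_eq
    · unfold Function.uncurry
      apply Measurable.add (by fun_prop)
      exact hr' _ _ (by fun_prop) (by fun_prop)
    · refine Filter.Eventually.of_forall fun x => ?_
      have : (fun s => z1.2 + s + resBO α z1.1 x) = fun s => (z1.2 + resBO α z1.1 x) + s := by
        ext s; ring
      rw [this]
      exact (measurePreserving_add_left volume _).map_eq

lemma tonelli_bound (Q : ℝ × ℝ → ℝ × ℝ → ℝ≥0∞) (F : ℝ × ℝ → ℝ≥0∞) (D : ℝ≥0∞)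
    (hQm : Measurable (fun w : (ℝ × ℝ) × (ℝ × ℝ) => Q w.2 w.1)) (hF : Measurable F)
    (hQ : ∀ z, ∫⁻ z1, Q z z1 ≤ D) :
    ∫⁻ w : (ℝ × ℝ) × (ℝ × ℝ), Q w.2 w.1 * F w.2 ≤ D * ∫⁻ z, F z := by
  have hHm : Measurable (fun w : (ℝ × ℝ) × (ℝ × ℝ) => Q w.2 w.1 * F w.2) :=
    hQm.mul (hF.comp measurable_snd)
  have e := lintegral_prod_symm' (μ := (volume : Measure (ℝ × ℝ)))
    (ν := (volume : Measure (ℝ × ℝ))) _ hHm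
  refine le_trans (le_of_eq e) ?_
  rw [← lintegral_const_mul _ hF]
  apply lintegral_mono
  intro z
  have hQz : Measurable (Q z) := hQm.comp (measurable_id.prodMk measurable_const)
  change ∫⁻ x, Q z x * F z ≤ D * F z
  rw [lintegral_mul_const _ hQz]
  exact mul_le_mul_left (hQ z) _

lemma inner_bound (α M p : ℝ) (hα : 0 < α) (hM : 0 < M) (hp : 1 < p) (I : ℝ × ℝ → ℝ≥0∞)
    (hIm : Measurable I)
    (hI : I = Set.indicator {x : ℝ × ℝ | M ≤ x.1 ∧ M ≤ x.2} (fun _ => (1:ℝ≥0∞)))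
    (z : ℝ × ℝ) :
    ∫⁻ z1 : ℝ × ℝ, ENNReal.ofReal (kk p z1.2) *
      (ENNReal.ofReal (kk p (z.2 - z1.2 - resBO α z1.1 (z.1 - z1.1))) * I (z1.1, z.1 - z1.1)) ≤
    2 * (ENNReal.ofReal ((M ^ α) ^ (-(1/2:ℝ)) * 2 ^ (p/2)) * ∫⁻ y, ENNReal.ofReal (kk p y))
      * ∫⁻ y, ENNReal.ofReal (kk p y) := by
  have hk := kk_meas p
  have hr := res_meas α
  have hr1 : Measurable (fun z1 : ℝ × ℝ => resBO α z1.1 (z.1 - z1.1)) :=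
    hr.comp (measurable_fst.prodMk (measurable_const.sub measurable_fst))
  have hr2 : Measurable (fun x : ℝ => resBO α x (z.1 - x)) :=
    hr.comp (measurable_id.prodMk (measurable_const.sub measurable_id))
  have hQz : Measurable (fun z1 : ℝ × ℝ => ENNReal.ofReal (kk p z1.2) *
      (ENNReal.ofReal (kk p (z.2 - z1.2 - resBO α z1.1 (z.1 - z1.1))) * I (z1.1, z.1 - z1.1))) := by
    fun_prop
  have e := lintegral_prod_symm' (μ := (volume : Measure ℝ)) (ν := (volume : Measure ℝ)) _ hQz
  refine le_trans (le_of_eq e) ?_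
  rw [← lintegral_const_mul _ (by fun_prop)]
  apply lintegral_mono
  intro s
  simp only
  rw [lintegral_const_mul _ (by fun_prop), mul_comm]
  refine mul_le_mul_left ?_ _
  refine le_trans (le_of_eq ?_) (int_phi α M z.1 p (-(z.2 - s + omegaBO α z.1)) hα hM hp)
  rw [← lintegral_indicator measurableSet_Icc]
  apply lintegral_congr
  intro x
  by_cases hx : x ∈ Set.Icc M (z.1 - M)
  · have h2 : M ≤ z.1 - x := by linarith [hx.2]
    rw [Set.indicator_of_mem hx, hI, Set.indicator_of_mem (by exact ⟨hx.1, h2⟩), mul_one,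
      res_phi α M z.1 x hM hx.1 h2]
    congr 2; ring
  · rw [Set.indicator_of_notMem hx, hI, Set.indicator_of_notMem, mul_zero]
    rintro ⟨h1, h2⟩
    simp only at h1 h2
    exact hx ⟨h1, by linarith⟩

lemma second (α M p : ℝ) (hα : 0 < α) (hM : 0 < M) (hp : 1 < p) (F : ℝ × ℝ → ℝ≥0∞)
    (hF : Measurable F) (I : ℝ × ℝ → ℝ≥0∞) (hIm : Measurable I)
    (hI : I = Set.indicator {x : ℝ × ℝ | M ≤ x.1 ∧ M ≤ x.2} (fun _ => (1:ℝ≥0∞))) :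
    ∫⁻ w : (ℝ × ℝ) × ℝ × ℝ, ENNReal.ofReal (kk p w.1.2) * ENNReal.ofReal (kk p w.2.2) *
      I (w.1.1, w.2.1) *
      F (w.1.1 + w.2.1, w.1.2 + w.2.2 + resBO α w.1.1 w.2.1) ≤
    (2 * (ENNReal.ofReal ((M ^ α) ^ (-(1/2:ℝ)) * 2 ^ (p/2)) * ∫⁻ y, ENNReal.ofReal (kk p y))
      * ∫⁻ y, ENNReal.ofReal (kk p y)) * ∫⁻ z, F z := by
  have hk := kk_meas p
  have hr : Measurable (fun w : (ℝ × ℝ) × (ℝ × ℝ) => resBO α w.1.1 (w.2.1 - w.1.1)) :=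
    (res_meas α).comp (g := fun z : ℝ × ℝ => resBO α z.1 z.2)
      (f := fun w : (ℝ × ℝ) × (ℝ × ℝ) => (w.1.1, w.2.1 - w.1.1)) (by fun_prop)
  have hQm : Measurable (fun w : (ℝ × ℝ) × (ℝ × ℝ) => ENNReal.ofReal (kk p w.1.2) *
      (ENNReal.ofReal (kk p (w.2.2 - w.1.2 - resBO α w.1.1 (w.2.1 - w.1.1))) *
        I (w.1.1, w.2.1 - w.1.1))) := by
    fun_prop
  have t := tonelli_bound (fun z z1 => ENNReal.ofReal (kk p z1.2) *
      (ENNReal.ofReal (kk p (z.2 - z1.2 - resBO α z1.1 (z.1 - z1.1))) * I (z1.1, z.1 - z1.1)))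
      F _ hQm hF (inner_bound α M p hα hM hp I hIm hI)
  refine le_trans (le_of_eq ?_) t
  have c := (shear_mp α).lintegral_comp (hQm.mul (hF.comp measurable_snd))
  refine Eq.trans ?_ c
  apply lintegral_congr
  intro w
  simp only [Pi.mul_apply, Function.comp, add_sub_cancel_left]
  rw [show w.1.2 + w.2.2 + resBO α w.1.1 w.2.1 - w.1.2 - resBO α w.1.1 w.2.1 = w.2.2 by ring]
  ring

lemma jap_pos (s : ℝ) : 0 < jap s := by unfold jap; positivity

lemma jap_meas : Measurable jap := by unfold jap; fun_prop

lemma jap_kk (b r s : ℝ) : (jap s ^ (-b)) ^ r = kk (b * r) s := by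
  unfold jap kk
  rw [← Real.rpow_mul (by positivity), ← Real.rpow_mul (by positivity)]
  congr 1; ring

lemma main_bound (α r r' b N₁ N₂ : ℝ) (hα0 : 0 < α) (hr1 : 1 < r)
    (hconj : 1 / r + 1 / r' = 1) (hb : 1 / r < b) (hN₁ : 1 ≤ N₁) (h12 : N₁ / 2 ≤ N₂)
    (f₁ f₂ f : ℝ × ℝ → ℝ) (m1 : Measurable f₁) (p1 : ∀ z, 0 ≤ f₁ z)
    (s1 : Function.support f₁ ⊆ {z : ℝ × ℝ | N₁ ≤ z.1 ∧ z.1 ≤ 2 * N₁})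
    (m2 : Measurable f₂) (p2 : ∀ z, 0 ≤ f₂ z)
    (s2 : Function.support f₂ ⊆ {z : ℝ × ℝ | N₂ ≤ z.1 ∧ z.1 ≤ 2 * N₂})
    (m : Measurable f) (p : ∀ z, 0 ≤ f z) :
    Jfun α f₁ f₂ f ≤
      (2 * (ENNReal.ofReal (((N₁/2) ^ α) ^ (-(1/2:ℝ)) * 2 ^ (b*r/2)) *
        ∫⁻ y, ENNReal.ofReal (kk (b*r) y)) * ∫⁻ y, ENNReal.ofReal (kk (b*r) y)) ^ (1 / r) *
            (LpN r' (fun z => jap z.2 ^ b * f₁ z) *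
              LpN r' (fun z => jap z.2 ^ b * f₂ z) * LpN r f) := by
  have hr0 : 0 < r := by linarith
  have hH : r'.HolderConjugate r := by
    refine Real.HolderConjugate.symm ?_
    rw [Real.holderConjugate_iff]
    exact ⟨hr1, by simpa using hconj⟩
  have hr'0 : 0 < r' := hH.pos
  have hp : 1 < b * r := by
    rwa [div_lt_iff₀ hr0] at hb
  have hj := jap_meas
  have hr := res_meas α
  have hr' : ∀ {γ : Type} [MeasurableSpace γ] (u v : γ → ℝ), Measurable u → Measurable v →
      Measurable (fun x => resBO α (u x) (v x)) := fun u v hu hv => hr.comp (hu.prodMk hv)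
  have hrw := hr' (fun w : (ℝ × ℝ) × (ℝ × ℝ) => w.1.1) (fun w => w.2.1) (by fun_prop) (by fun_prop)
  have hS : MeasurableSet {x : ℝ × ℝ | N₁/2 ≤ x.1 ∧ N₁/2 ≤ x.2} :=
    (measurableSet_le measurable_const measurable_fst).inter
      (measurableSet_le measurable_const measurable_snd)
  set I : ℝ × ℝ → ℝ≥0∞ := Set.indicator {x : ℝ × ℝ | N₁/2 ≤ x.1 ∧ N₁/2 ≤ x.2}
    (fun _ => (1:ℝ≥0∞)) with hI
  have hIm : Measurable I := measurable_const.indicator hS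
  let G₁ : ℝ × ℝ → ℝ≥0∞ := fun z => ENNReal.ofReal (jap z.2 ^ b * f₁ z)
  let G₂ : ℝ × ℝ → ℝ≥0∞ := fun z => ENNReal.ofReal (jap z.2 ^ b * f₂ z)
  have hG₁ : Measurable G₁ := by simp only [G₁]; fun_prop
  have hG₂ : Measurable G₂ := by simp only [G₂]; fun_prop
  let A : (ℝ × ℝ) × ℝ × ℝ → ℝ≥0∞ := fun w => G₁ w.1 * G₂ w.2
  let B : (ℝ × ℝ) × ℝ × ℝ → ℝ≥0∞ := fun w =>
    ENNReal.ofReal (jap w.1.2 ^ (-b)) * ENNReal.ofReal (jap w.2.2 ^ (-b)) * I (w.1.1, w.2.1) *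
      ENNReal.ofReal (f (w.1.1 + w.2.1, w.1.2 + w.2.2 + resBO α w.1.1 w.2.1))
  have hA : Measurable A := by simp only [A]; fun_prop
  have hB : Measurable B := by simp only [B]; fun_prop
  have step1 : Jfun α f₁ f₂ f ≤ ∫⁻ w, (A * B) w := by
    unfold Jfun
    apply lintegral_mono
    intro w
    simp only [Pi.mul_apply]
    by_cases h1 : f₁ w.1 = 0
    · simp [h1]
    by_cases h2 : f₂ w.2 = 0
    · simp [h2]
    have q1 := (s1 h1).1
    have q2 := (s2 h2).1
    have hi : I (w.1.1, w.2.1) = 1 := by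
      rw [hI, Set.indicator_of_mem]
      exact ⟨by linarith, by linarith⟩
    have c1 : jap w.1.2 ^ b * jap w.1.2 ^ (-b) = 1 := by
      rw [← Real.rpow_add (jap_pos _)]; simp
    have c2 : jap w.2.2 ^ b * jap w.2.2 ^ (-b) = 1 := by
      rw [← Real.rpow_add (jap_pos _)]; simp
    have j1 := Real.rpow_nonneg (jap_pos w.1.2).le b
    have j2 := Real.rpow_nonneg (jap_pos w.2.2).le b
    have j3 := Real.rpow_nonneg (jap_pos w.1.2).le (-b)
    have j4 := Real.rpow_nonneg (jap_pos w.2.2).le (-b)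
    have := p1 w.1
    have := p2 w.2
    simp only [A, B, G₁, G₂, hi, mul_one]
    rw [← ENNReal.ofReal_mul (by positivity), ← ENNReal.ofReal_mul (by positivity),
      ← ENNReal.ofReal_mul (by positivity), ← ENNReal.ofReal_mul (by positivity)]
    apply le_of_eq
    congr 1
    calc _ = (jap w.1.2 ^ b * jap w.1.2 ^ (-b)) * (jap w.2.2 ^ b * jap w.2.2 ^ (-b)) * (f₁ w.1 * f₂ w.2 *
      f (w.1.1 + w.2.1, w.1.2 + w.2.2 + resBO α w.1.1 w.2.1)) := by rw [c1, c2]; simp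
      _ = _ := by ring
  have step2 := ENNReal.lintegral_mul_le_Lp_mul_Lq volume hH hA.aemeasurable hB.aemeasurable
  refine (step1.trans step2).trans ?_
  have eA : (∫⁻ w, A w ^ r') ^ (1 / r') = LpN r' (fun z => jap z.2 ^ b * f₁ z) *
              LpN r' (fun z => jap z.2 ^ b * f₂ z) := by
    unfold LpN
    rw [← ENNReal.mul_rpow_of_nonneg _ _ (by positivity)]
    congr 1
    simp only [A, ENNReal.mul_rpow_of_nonneg _ _ hr'0.le]
    rw [Measure.volume_eq_prod]
    exact lintegral_prod_mul (f := fun z => G₁ z ^ r') (g := fun z => G₂ z ^ r')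
      (by fun_prop) (by fun_prop)
  have eB0 := second α (N₁/2) (b*r) hα0 (by linarith) hp
      (fun z => ENNReal.ofReal (f z) ^ r) (by fun_prop) I hIm hI
  have eB := le_trans (b := ∫⁻ w, B w ^ r) (le_of_eq rfl) (le_trans (le_of_eq (by
    apply lintegral_congr
    intro w
    simp only [B, ENNReal.mul_rpow_of_nonneg _ _ hr0.le]
    rw [ENNReal.ofReal_rpow_of_nonneg (Real.rpow_nonneg (jap_pos _).le _) hr0.le,
      ENNReal.ofReal_rpow_of_nonneg (Real.rpow_nonneg (jap_pos _).le _) hr0.le, jap_kk, jap_kk]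
    congr 2
    rw [hI]
    by_cases h : (w.1.1, w.2.1) ∈ {x : ℝ × ℝ | N₁/2 ≤ x.1 ∧ N₁/2 ≤ x.2}
    · rw [Set.indicator_of_mem h, ENNReal.one_rpow]
    · rw [Set.indicator_of_notMem h, ENNReal.zero_rpow_of_pos hr0])) eB0)
  rw [eA]
  have eB' := ENNReal.rpow_le_rpow eB (z := 1 / r) (by positivity)
  rw [ENNReal.mul_rpow_of_nonneg _ _ (by positivity : 0 ≤ 1 / r)] at eB'
  calc _ ≤ _ := mul_le_mul_right eB' _
    _ = _ := by
      unfold LpN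
      ring

/-- High×high interactions with equal signs (Lemma 3.3 (a), second part). -/
theorem stmt10 (α r r' b : ℝ) (hα0 : 0 < α) (hα1 : α ≤ 1)
    (hr1 : 1 < r) (hr2 : r ≤ 2) (hconj : 1 / r + 1 / r' = 1) (hb : 1 / r < b) :
    ∃ C > (0 : ℝ), ∀ N₁ N₂ : ℝ, 1 ≤ N₁ → 1 ≤ N₂ →
      N₁ / 2 ≤ N₂ → N₂ ≤ 2 * N₁ →
      ∀ f₁ f₂ f : ℝ × ℝ → ℝ,
        Measurable f₁ → (∀ z, 0 ≤ f₁ z) →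
        Function.support f₁ ⊆ {z : ℝ × ℝ | N₁ ≤ z.1 ∧ z.1 ≤ 2 * N₁} →
        Measurable f₂ → (∀ z, 0 ≤ f₂ z) →
        Function.support f₂ ⊆ {z : ℝ × ℝ | N₂ ≤ z.1 ∧ z.1 ≤ 2 * N₂} →
        Measurable f → (∀ z, 0 ≤ f z) →
        Jfun α f₁ f₂ f ≤
          ENNReal.ofReal (C * N₁ ^ (-(α / (2 * r)))) *
            (LpN r' (fun z => jap z.2 ^ b * f₁ z) *
              LpN r' (fun z => jap z.2 ^ b * f₂ z) * LpN r f) := by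
  have hr0 : 0 < r := by linarith
  have hp : 1 < b * r := by
    rwa [div_lt_iff₀ hr0] at hb
  have hA := kk_int (b*r) hp
  set A := ∫⁻ y, ENNReal.ofReal (kk (b*r) y) with hAdef
  let E : ℝ := 2 * ((2:ℝ) ^ (α/2) * 2 ^ (b*r/2) * A.toReal) * A.toReal
  have hE : 0 ≤ E := by positivity
  refine ⟨E ^ (1/r) + 1, by positivity, ?_⟩
  intro N₁ N₂ hN₁ hN₂ h12 h21 f₁ f₂ f m1 p1 s1 m2 p2 s2 m p
  refine (main_bound α r r' b N₁ N₂ hα0 hr1 hconj hb hN₁ h12 f₁ f₂ f m1 p1 s1 m2 p2 s2 m p).trans ?_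
  apply mul_le_mul_left
  rw [← hAdef]
  have hN0 : 0 < N₁ := by linarith
  have hpow : ((N₁/2) ^ α) ^ (-(1/2:ℝ)) = N₁ ^ (-(α/2)) * 2 ^ (α/2) := by
    rw [← Real.rpow_mul (by positivity), show α * -(1/2) = -(α/2) by ring,
      Real.div_rpow hN0.le (by norm_num), Real.rpow_neg (by norm_num : (0:ℝ) ≤ 2), div_inv_eq_mul]
  have e1 : (2 * (ENNReal.ofReal (((N₁/2) ^ α) ^ (-(1/2:ℝ)) * 2 ^ (b*r/2)) * A) * A) =
      ENNReal.ofReal (E * N₁ ^ (-(α/2))) := by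
    rw [hpow]
    conv_lhs => rw [← ENNReal.ofReal_toReal hA.ne]
    rw [show (2:ℝ≥0∞) = ENNReal.ofReal 2 by simp, ← ENNReal.ofReal_mul (by positivity),
      ← ENNReal.ofReal_mul (by positivity), ← ENNReal.ofReal_mul (by positivity)]
    congr 1
    simp only [E]; ring
  rw [e1, ENNReal.ofReal_rpow_of_nonneg (by positivity) (by positivity)]
  apply ENNReal.ofReal_le_ofReal
  rw [Real.mul_rpow hE (by positivity), ← Real.rpow_mul hN0.le,
    show -(α/2) * (1/r) = -(α/(2*r)) by field_simp]
  gcongr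
  linarith
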